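/- arXiv:1803.06837 — 3 statements merged into one kernel-verified Lean document; each statement's English description precedes it below -/
import Mathlib

section
/- The function K₃ : [0,∞) → ℝ defined by K₃(t) = ln(e + ln(e + t)) · ln(e + t) satisfies hypothesis (K) with σ₀ = 5/6; namely: K₃ is continuously differentiable, K₃(t) ≥ 1 for all t ≥ 0, K₃ is strictly increasing, K₃(t) → +∞ as t → +∞, K₃(t) ≤ (ln(e + t))² for all t ≥ 2, and t·K₃′(t) ≤ (5/6)·K₃(t) for all t ≥ 0. -/
open Real Set Filter

lemma one_le_log_exp_one_add {x : ℝ} (hx : 0 ≤ x) : 1 ≤ Real.log (Real.exp 1 + x) := by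
  rw [Real.le_log_iff_exp_le (by positivity)]
  linarith

lemma log_exp_one_add_lt {x y : ℝ} (hx : 0 ≤ x) (hxy : x < y) :
    Real.log (Real.exp 1 + x) < Real.log (Real.exp 1 + y) :=
  Real.log_lt_log (by positivity) (by linarith)

lemma log_exp_one_add_le_self {t : ℝ} (ht : 2 ≤ t) : Real.log (Real.exp 1 + t) ≤ t := by
  rw [Real.log_le_iff_le_exp (by positivity)]
  have h₁ : Real.exp t = Real.exp 1 * Real.exp (t - 1) := by
    rw [← Real.exp_add]
    ring_nf
  have h₂ := Real.add_one_le_exp (t - 1)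
  have h₃ := Real.add_one_le_exp (1 : ℝ)
  rw [h₁]
  nlinarith

lemma tendsto_log_exp_one_add_atTop :
    Tendsto (fun t : ℝ => Real.log (Real.exp 1 + t)) atTop atTop :=
  Real.tendsto_log_atTop.comp (tendsto_atTop_add_const_left _ _ tendsto_id)

lemma div_exp_one_add_le_half_log {t : ℝ} (ht : 0 ≤ t) :
    t / (Real.exp 1 + t) ≤ Real.log (Real.exp 1 + t) / 2 := by
  have he := Real.exp_pos 1
  have hpos : 0 < Real.exp 1 + t := by positivity
  have h := Real.one_sub_inv_le_log_of_pos (div_pos hpos he)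
  rw [Real.log_div hpos.ne' he.ne', Real.log_exp, inv_div] at h
  have hsplit : Real.exp 1 / (Real.exp 1 + t) = 1 - t / (Real.exp 1 + t) := by
    field_simp
    ring
  have hle : t / (Real.exp 1 + t) ≤ 1 := (div_le_one hpos).2 (by linarith)
  linarith

lemma hasDerivAt_log_log_mul_log {t : ℝ} (ht : 0 ≤ t) :
    HasDerivAt (fun t => Real.log (Real.exp 1 + Real.log (Real.exp 1 + t)) *
        Real.log (Real.exp 1 + t))
      (1 / (Real.exp 1 + t) / (Real.exp 1 + Real.log (Real.exp 1 + t)) *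
          Real.log (Real.exp 1 + t) +
        Real.log (Real.exp 1 + Real.log (Real.exp 1 + t)) * (1 / (Real.exp 1 + t))) t := by
  have hL := one_le_log_exp_one_add ht
  have hlog : HasDerivAt (fun t => Real.log (Real.exp 1 + t)) (1 / (Real.exp 1 + t)) t :=
    ((hasDerivAt_id t).const_add (Real.exp 1)).log (by simp only [id]; positivity)
  exact ((hlog.const_add (Real.exp 1)).log (by positivity)).mul hlog

theorem K3_satisfies_hypothesis_K :
    ∀ K₃ : ℝ → ℝ,
      (K₃ = fun t => Real.log (Real.exp 1 + Real.log (Real.exp 1 + t)) *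
        Real.log (Real.exp 1 + t)) →
      ContDiffOn ℝ 1 K₃ (Set.Ici 0) ∧
      (∀ t ≥ (0 : ℝ), 1 ≤ K₃ t) ∧
      StrictMonoOn K₃ (Set.Ici 0) ∧
      Filter.Tendsto K₃ Filter.atTop Filter.atTop ∧
      (∀ t ≥ (2 : ℝ), K₃ t ≤ (Real.log (Real.exp 1 + t)) ^ 2) ∧
      (∀ t ≥ (0 : ℝ), t * deriv K₃ t ≤ (5 / 6) * K₃ t) := by
  rintro K₃ rfl
  have hL {t : ℝ} (ht : 0 ≤ t) : 1 ≤ Real.log (Real.exp 1 + t) := one_le_log_exp_one_add ht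
  have hM {t : ℝ} (ht : 0 ≤ t) : 1 ≤ Real.log (Real.exp 1 + Real.log (Real.exp 1 + t)) :=
    one_le_log_exp_one_add (zero_le_one.trans (hL ht))
  refine ⟨?_, fun t ht => one_le_mul_of_one_le_of_one_le (hM ht) (hL ht), ?_, ?_, ?_, ?_⟩
  · have hlog : ContDiffOn ℝ 1 (fun t => Real.log (Real.exp 1 + t)) (Set.Ici 0) :=
      (contDiffOn_const.add contDiffOn_id).log fun t (ht : 0 ≤ t) => by
        simp only [id]
        positivity
    refine ((contDiffOn_const.add hlog).log fun t ht => ?_).mul hlog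
    have := hL ht
    positivity
  · intro x (hx : 0 ≤ x) y (hy : 0 ≤ y) hxy
    have h₁ := log_exp_one_add_lt hx hxy
    have h₂ := log_exp_one_add_lt (zero_le_one.trans (hL hx)) h₁
    exact mul_lt_mul'' h₂ h₁ (zero_le_one.trans (hM hx)) (zero_le_one.trans (hL hx))
  · exact (tendsto_log_exp_one_add_atTop.comp tendsto_log_exp_one_add_atTop).atTop_mul_atTop₀
      tendsto_log_exp_one_add_atTop
  · intro t ht
    have ht₀ : 0 ≤ t := by linarith
    have h := hL ht₀
    simp only [sq]
    gcongr
    exact log_exp_one_add_le_self ht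
  · intro t ht
    rw [(hasDerivAt_log_log_mul_log ht).deriv]
    have hu := div_exp_one_add_le_half_log ht
    have hLt := hL ht
    have hMt := hM ht
    have hpos : 0 < Real.exp 1 + t := by positivity
    have hu₁ : t / (Real.exp 1 + t) ≤ 1 := (div_le_one hpos).2 (by linarith [Real.exp_pos 1])
    have he := Real.add_one_le_exp (1 : ℝ)
    set L := Real.log (Real.exp 1 + t)
    set M := Real.log (Real.exp 1 + L)
    set u := t / (Real.exp 1 + t) with hu_def
    have hfirst : u / (Real.exp 1 + L) ≤ 1 / 3 :=
      div_le_div₀ zero_le_one hu₁ (by norm_num) (by linarith)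
    calc t * (1 / (Real.exp 1 + t) / (Real.exp 1 + L) * L + M * (1 / (Real.exp 1 + t)))
        = u / (Real.exp 1 + L) * L + M * u := by
          rw [hu_def]
          ring
      _ ≤ 1 / 3 * L + M * (L / 2) := by gcongr
      _ ≤ 5 / 6 * (M * L) := by nlinarith
end

section
/- Let Ω ⊂ ℝ^N be a bounded open set, p a C¹ function on a neighborhood of the closure of Ω with p(x) > 1 for all x, and x₀ ∈ Ω a point with ∇p(x₀) ≠ 0. Let F : Ω × ℝ → ℝ be a Carathéodory function (measurable in x, continuous in t) such that |F(x,t)| ≤ C(1 + |t|^{α(x)}) for some constant C > 0 and some continuous bounded function α, and such that F(x,t)/(|t|^{p(x)} · (ln(e + |t|))^{p(x)}) → +∞ as |t| → +∞, uniformly in x ∈ Ω. Then there exists ε > 0 with closedBall(x₀, ε) ⊂ Ω such that, setting h(x) = max(ε − |x − x₀|, 0), one has ∫_{B(x₀,ε)} t^{p(x)} dx − ∫_{B(x₀,ε)} F(x, t·h(x)) dx → −∞ as t → +∞. -/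
open Set Metric Filter MeasureTheory

section Contraction

variable {E : Type*} [NormedAddCommGroup E] [NormedSpace ℝ E]

/-- Change of variables for the homothety of ratio `R` centred at `x₀`. -/
theorem setIntegral_ball_mul_radius [MeasurableSpace E] [BorelSpace E] [FiniteDimensional ℝ E]
    (μ : Measure E) [μ.IsAddHaarMeasure] (g : E → ℝ) (x₀ : E) (ε : ℝ) {R : ℝ} (hR : 0 < R) :
    ∫ x in ball x₀ (R * ε), g x ∂μ =
      R ^ Module.finrank ℝ E * ∫ x in ball x₀ ε, g (x₀ + R • (x - x₀)) ∂μ := by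
  have translate : ∀ (f : E → ℝ) (r : ℝ),
      ∫ x in ball x₀ r, f x ∂μ = ∫ x in ball 0 r, f (x₀ + x) ∂μ := by
    intro f r
    have h := (measurePreserving_add_left μ x₀).setIntegral_preimage_emb
      (measurableEmbedding_addLeft x₀) f (ball x₀ r)
    rw [← h, preimage_add_ball, sub_self]
  rw [translate g, translate (fun x => g (x₀ + R • (x - x₀)))]
  simp only [add_sub_cancel_left]
  rw [Measure.setIntegral_comp_smul μ (fun y => g (x₀ + y)) (ball 0 ε) hR.ne',
    _root_.smul_ball hR.ne', smul_zero, Real.norm_of_nonneg hR.le, smul_eq_mul,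
    abs_of_pos (by positivity), mul_inv_cancel_left₀ (by positivity)]

theorem integrableOn_rpow_ball [MeasurableSpace E] [BorelSpace E] [FiniteDimensional ℝ E]
    (μ : Measure E) [IsFiniteMeasureOnCompacts μ] {p : E → ℝ} {x₀ : E} {ε : ℝ}
    (hp : ContinuousOn p (closedBall x₀ ε)) {t : ℝ} (ht : 0 < t) :
    IntegrableOn (fun x => t ^ p x) (ball x₀ ε) μ :=
  (ContinuousOn.integrableOn_compact (isCompact_closedBall x₀ ε)
    (continuousOn_const.rpow hp fun _ _ => Or.inl ht.ne')).mono_set ball_subset_closedBall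

theorem mul_setIntegral_rpow_le_setIntegral_ball_mul_radius
    [MeasurableSpace E] [BorelSpace E] [FiniteDimensional ℝ E]
    (μ : Measure E) [μ.IsAddHaarMeasure] {p : E → ℝ} {x₀ : E} {ε : ℝ} {K : NNReal}
    (hp : LipschitzOnWith K p (closedBall x₀ ε)) {t R : ℝ} (ht : 1 ≤ t)
    (hR : 0 < R) (hR1 : R ≤ 1) :
    R ^ Module.finrank ℝ E * (t ^ (-(K * ((1 - R) * ε))) * ∫ x in ball x₀ ε, t ^ p x ∂μ) ≤
      ∫ x in ball x₀ (R * ε), t ^ p x ∂μ := by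
  have ht0 : 0 < t := by linarith
  rw [setIntegral_ball_mul_radius μ (fun x => t ^ p x) x₀ ε hR, ← integral_const_mul]
  have mem : ∀ x ∈ closedBall x₀ ε, x₀ + R • (x - x₀) ∈ closedBall x₀ ε := by
    intro x hx
    rw [mem_closedBall, dist_eq_norm] at hx ⊢
    rw [add_sub_cancel_left, norm_smul, Real.norm_of_nonneg hR.le]
    nlinarith [norm_nonneg (x - x₀)]
  refine mul_le_mul_of_nonneg_left (setIntegral_mono_on ?_ ?_ measurableSet_ball ?_) (by positivity)
  · exact (integrableOn_rpow_ball μ hp.continuousOn ht0).const_mul _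
  · exact integrableOn_rpow_ball μ (p := fun x => p (x₀ + R • (x - x₀)))
      (hp.continuousOn.comp (by fun_prop) mem) ht0
  · intro x hx
    have hx' := ball_subset_closedBall hx
    rw [← Real.rpow_add ht0]
    refine Real.rpow_le_rpow_of_exponent_le ht ?_
    have h1 := hp.dist_le_mul x hx' _ (mem x hx')
    have h2 : dist x (x₀ + R • (x - x₀)) = (1 - R) * ‖x - x₀‖ := by
      rw [dist_eq_norm, show x - (x₀ + R • (x - x₀)) = (1 - R) • (x - x₀) by module,
        norm_smul, Real.norm_of_nonneg (by linarith)]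
    rw [h2, Real.dist_eq] at h1
    have h3 : (1 - R) * ‖x - x₀‖ ≤ (1 - R) * ε := by
      refine mul_le_mul_of_nonneg_left ?_ (by linarith)
      rw [← dist_eq_norm]; exact hx'
    have h4 := mul_le_mul_of_nonneg_left h3 K.coe_nonneg
    linarith [le_abs_self (p x - p (x₀ + R • (x - x₀)))]

end Contraction

section Nonlinearity

/-- A superlogarithmic lower bound forces the growth exponent to be positive. -/
theorem growth_exponent_pos {f : ℝ → ℝ} {p a C M : ℝ} (hp : 1 ≤ p)
    (hgrowth : ∀ t : ℝ, |f t| ≤ C * (1 + |t| ^ a)) (hC : 0 < C)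
    (hdiv : ∀ t : ℝ, M ≤ |t| →
      1 ≤ f t / (|t| ^ p * (Real.log (Real.exp 1 + |t|)) ^ p)) : 0 < a := by
  by_contra! ha
  set t : ℝ := max M (max 1 (2 * C + 1)) with ht
  have ht1 : 1 ≤ t := (le_max_left _ _).trans (le_max_right _ _)
  have htC : 2 * C + 1 ≤ t := (le_max_right _ _).trans (le_max_right _ _)
  have habs : |t| = t := abs_of_pos (by linarith)
  have h1 := hdiv t (by rw [habs]; exact le_max_left _ _)
  have h2 := hgrowth t
  rw [habs] at h1 h2
  have hlog : 1 ≤ Real.log (Real.exp 1 + t) := by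
    rw [Real.le_log_iff_exp_le (by positivity)]; linarith
  have hlogp : 1 ≤ Real.log (Real.exp 1 + t) ^ p := Real.one_le_rpow hlog (by linarith)
  have htp : t ≤ t ^ p := Real.self_le_rpow_of_one_le ht1 hp
  rw [le_div_iff₀ (by positivity), one_mul] at h1
  have h3 : t ^ a ≤ 1 := Real.rpow_le_one_of_one_le_of_nonpos ht1 ha
  nlinarith [le_abs_self (f t)]

theorem abs_le_of_growth {f : ℝ → ℝ} {a A C s T : ℝ} (hC : 0 < C)
    (hgrowth : ∀ t : ℝ, |f t| ≤ C * (1 + |t| ^ a)) (ha : 0 < a) (haA : a ≤ A)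
    (hs : |s| ≤ T) (hT : 1 ≤ T) : |f s| ≤ C * (1 + T ^ A) := by
  refine (hgrowth s).trans ?_
  have h1 : |s| ^ a ≤ T ^ a := Real.rpow_le_rpow (abs_nonneg s) hs ha.le
  have h2 : T ^ a ≤ T ^ A := Real.rpow_le_rpow_of_exponent_le hT haA
  gcongr
  exact h1.trans h2

/-- Where the height `h` is at least `ε / log t`, the logarithmic factor compensates `h`. -/
theorem mul_rpow_le_of_superlog {f : ℝ → ℝ} {p P L M ε h t : ℝ} (hL : 0 < L) (hp : 1 ≤ p)
    (hpP : p ≤ P) (hε : 0 < ε) (ht : 1 < t) (hM : M ≤ √t)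
    (hlog : Real.log t ≤ ε * √t) (hh : ε / Real.log t ≤ h)
    (hdiv : ∀ t : ℝ, M ≤ |t| →
      L ≤ f t / (|t| ^ p * (Real.log (Real.exp 1 + |t|)) ^ p)) :
    L * min (ε / 2) 1 ^ P * t ^ p ≤ f (t * h) := by
  have ht0 : 0 < t := by linarith
  have hlt : 0 < Real.log t := Real.log_pos ht
  have hh0 : 0 < h := lt_of_lt_of_le (by positivity) hh
  have hsq : √t ≤ t * h := by
    have h1 : √t * √t = t := Real.mul_self_sqrt ht0.le
    have h2 : √t ≤ t * (ε / Real.log t) := by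
      rw [← mul_div_assoc, le_div_iff₀ hlt]
      nlinarith [Real.sqrt_nonneg t]
    exact h2.trans (mul_le_mul_of_nonneg_left hh ht0.le)
  have hth : 0 < t * h := by positivity
  have habs : |t * h| = t * h := abs_of_pos hth
  have h1 := hdiv (t * h) (by rw [habs]; exact hM.trans hsq)
  rw [habs] at h1
  set l := Real.log (Real.exp 1 + t * h) with hl
  have hl2 : Real.log t / 2 ≤ l := by
    rw [← Real.log_sqrt ht0.le]
    exact Real.log_le_log (by positivity) (by linarith [Real.exp_pos 1])
  have hl0 : 0 < l := by linarith
  rw [le_div_iff₀ (by positivity), Real.mul_rpow ht0.le hh0.le, mul_assoc,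
    ← Real.mul_rpow hh0.le hl0.le] at h1
  have hm0 : 0 < min (ε / 2) 1 := by positivity
  have hhl : min (ε / 2) 1 ≤ h * l := by
    refine (min_le_left _ _).trans ?_
    calc ε / 2 = ε / Real.log t * (Real.log t / 2) := by field_simp
      _ ≤ h * l := by gcongr
  have h2 : min (ε / 2) 1 ^ P ≤ (h * l) ^ p :=
    (Real.rpow_le_rpow_of_exponent_ge hm0 (min_le_right _ _) hpP).trans
      (Real.rpow_le_rpow hm0.le hhl (by linarith))
  refine le_trans ?_ h1
  rw [mul_assoc, mul_comm (_ ^ P)]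
  gcongr

end Nonlinearity

theorem energy_tendsto_atBot_of_superlog_growth {N : ℕ}
    (Ω U : Set (EuclideanSpace ℝ (Fin N)))
    (hΩo : IsOpen Ω) (hΩb : Bornology.IsBounded Ω)
    (hU : IsOpen U) (hclU : closure Ω ⊆ U)
    (p : EuclideanSpace ℝ (Fin N) → ℝ)
    (hp : ContDiffOn ℝ 1 p U) (hp1 : ∀ x ∈ U, 1 < p x)
    (x₀ : EuclideanSpace ℝ (Fin N)) (hx₀ : x₀ ∈ Ω) (hgrad : gradient p x₀ ≠ 0)
    (F : EuclideanSpace ℝ (Fin N) → ℝ → ℝ)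
    (hFmeas : ∀ t : ℝ, Measurable fun x => F x t)
    (hFcont : ∀ x, Continuous (F x))
    (α : EuclideanSpace ℝ (Fin N) → ℝ) (hα : Continuous α)
    (A : ℝ) (hA : ∀ x, |α x| ≤ A)
    (C : ℝ) (hC : 0 < C)
    (hgrowth : ∀ x ∈ Ω, ∀ t : ℝ, |F x t| ≤ C * (1 + |t| ^ α x))
    (hdiv : ∀ L : ℝ, ∃ M : ℝ, ∀ x ∈ Ω, ∀ t : ℝ, M ≤ |t| →
      L ≤ F x t / (|t| ^ p x * (Real.log (Real.exp 1 + |t|)) ^ p x)) :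
    ∃ ε > (0 : ℝ), closedBall x₀ ε ⊆ Ω ∧
      Filter.Tendsto (fun t : ℝ =>
        (∫ x in ball x₀ ε, t ^ p x) -
          ∫ x in ball x₀ ε, F x (t * max (ε - ‖x - x₀‖) 0))
        Filter.atTop Filter.atBot := by
  have hΩU : Ω ⊆ U := subset_closure.trans hclU
  obtain ⟨K, V, hV, hKV⟩ :=
    (hp.contDiffAt (hU.mem_nhds (hΩU hx₀))).exists_lipschitzOnWith
  obtain ⟨ε, hε, hball⟩ := nhds_basis_closedBall.mem_iff.1
    (inter_mem hV (hΩo.mem_nhds hx₀))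
  have hεΩ : closedBall x₀ ε ⊆ Ω := hball.trans inter_subset_right
  have hlip : LipschitzOnWith K p (closedBall x₀ ε) := hKV.mono (hball.trans inter_subset_left)
  refine ⟨ε, hε, hεΩ, ?_⟩
  have hballΩ : ball x₀ ε ⊆ Ω := ball_subset_closedBall.trans hεΩ
  have hp1' : ∀ x ∈ Ω, 1 ≤ p x := fun x hx => (hp1 x (hΩU hx)).le
  obtain ⟨P, hP⟩ : ∃ P, ∀ x ∈ closedBall x₀ ε, p x ≤ P := by
    obtain ⟨P, hP⟩ := (isCompact_closedBall x₀ ε).bddAbove_image hlip.continuousOn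
    exact ⟨P, fun x hx => hP (mem_image_of_mem p hx)⟩
  have hαpos : ∀ x ∈ Ω, 0 < α x := by
    obtain ⟨M, hM⟩ := hdiv 1
    exact fun x hx => growth_exponent_pos (hp1' x hx) (hgrowth x hx) hC (hM x hx)
  have hαA : ∀ x, α x ≤ A := fun x => (le_abs_self _).trans (hA x)
  obtain ⟨B, hB0, hB⟩ : ∃ B, 0 ≤ B ∧ ∀ x ∈ Ω, ∀ s, -B ≤ F x s := by
    obtain ⟨M, hM⟩ := hdiv 1
    refine ⟨C * (1 + max M 1 ^ A), by positivity, fun x hx s => ?_⟩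
    rcases le_total |s| (max M 1) with hs | hs
    · exact neg_le_of_abs_le
        (abs_le_of_growth hC (hgrowth x hx) (hαpos x hx) (hαA x) hs (le_max_right _ _))
    · have h1 := hM x hx s ((le_max_left _ _).trans hs)
      have h2 : 0 < |s| := lt_of_lt_of_le (by positivity) hs
      have h3 : 0 < Real.log (Real.exp 1 + |s|) :=
        Real.log_pos (by linarith [Real.add_one_le_exp 1])
      rw [le_div_iff₀ (by positivity), one_mul] at h1
      have h4 : 0 < |s| ^ p x * Real.log (Real.exp 1 + |s|) ^ p x := by positivity
      have h5 : 0 ≤ C * (1 + max M 1 ^ A) := by positivity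
      linarith
  set H : EuclideanSpace ℝ (Fin N) → ℝ := fun x => max (ε - ‖x - x₀‖) 0 with hH
  have hHc : Continuous H := by fun_prop
  have hH0 : ∀ x, 0 ≤ H x := fun x => le_max_right _ _
  have hHε : ∀ x, H x ≤ ε := fun x => max_le (by linarith [norm_nonneg (x - x₀)]) hε.le
  have hint : ∀ t : ℝ, IntegrableOn (fun x => F x (t * H x)) (ball x₀ ε) := by
    intro t
    have hmeas : Measurable fun x => F x (t * H x) :=
      (measurable_uncurry_of_continuous_of_measurable (u := fun s x => F x s)
        hFcont hFmeas).comp ((hHc.measurable.const_mul t).prodMk measurable_id)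
    refine Measure.integrableOn_of_bounded measure_ball_lt_top.ne hmeas.aestronglyMeasurable
      (M := C * (1 + max (|t| * ε) 1 ^ A)) ?_
    refine ae_restrict_of_forall_mem measurableSet_ball fun x hx => ?_
    refine abs_le_of_growth hC (hgrowth x (hballΩ hx)) (hαpos x (hballΩ hx)) (hαA x) ?_
      (le_max_right _ _)
    rw [abs_mul, abs_of_nonneg (hH0 x)]
    exact (mul_le_mul_of_nonneg_left (hHε x) (abs_nonneg t)).trans (le_max_left _ _)
  set c : ℝ := (1 / 2) ^ N * Real.exp (-(K * ε)) with hc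
  have hc0 : 0 < c := by positivity
  set m : ℝ := min (ε / 2) 1 ^ P with hm
  have hm0 : 0 < m := by
    have : 0 < min (ε / 2) 1 := by positivity
    positivity
  set L : ℝ := 2 / (c * m) with hLdef
  have hL : 0 < L := by positivity
  obtain ⟨M, hM⟩ := hdiv L
  set b : ℝ := volume.real (ball x₀ ε) with hb
  have hb0 : 0 < b := ENNReal.toReal_pos (measure_ball_pos volume x₀ hε).ne'
    measure_ball_lt_top.ne
  have key : ∀ᶠ t : ℝ in atTop,
      (∫ x in ball x₀ ε, t ^ p x) - ∫ x in ball x₀ ε, F x (t * H x) ≤ B * b - b * t := by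
    have hlog : ∀ᶠ t : ℝ in atTop, Real.log t ≤ ε * √t := by
      filter_upwards [(isLittleO_log_rpow_atTop (r := 1 / 2) (by norm_num)).bound hε,
        eventually_ge_atTop 0] with t h ht
      rw [← Real.sqrt_eq_rpow, Real.norm_of_nonneg (Real.sqrt_nonneg t)] at h
      exact (le_abs_self _).trans h
    filter_upwards [hlog, eventually_ge_atTop (Real.exp 2),
      Real.tendsto_sqrt_atTop.eventually_ge_atTop M] with t hlt hte hMt
    have ht1 : 1 < t := by linarith [Real.add_one_le_exp 2]
    have ht0 : 0 < t := by linarith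
    have hlog2 : 2 ≤ Real.log t := (Real.le_log_iff_exp_le ht0).2 hte
    set R : ℝ := 1 - 1 / Real.log t with hR
    have hδ : 1 / Real.log t ≤ 1 / 2 := one_div_le_one_div_of_le (by norm_num) hlog2
    have hδ0 : 0 < 1 / Real.log t := by positivity
    have hR2 : 1 / 2 ≤ R := by linarith
    have hR1 : R ≤ 1 := by linarith
    have hR0 : 0 < R := by linarith
    have hRε : R * ε ≤ ε := by nlinarith
    have hpint : IntegrableOn (fun x => t ^ p x) (ball x₀ ε) :=
      integrableOn_rpow_ball volume hlip.continuousOn ht0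
    set I : ℝ := ∫ x in ball x₀ ε, t ^ p x with hI
    have hconst : IntegrableOn (fun _ => B) (ball x₀ ε)
        (volume : Measure (EuclideanSpace ℝ (Fin N))) :=
      integrableOn_const measure_ball_lt_top.ne
    have hIt : b * t ≤ I := by
      have : ∫ _ in ball x₀ ε, t ≤ I :=
        setIntegral_mono_on (integrableOn_const measure_ball_lt_top.ne) hpint measurableSet_ball
          fun x hx => Real.self_le_rpow_of_one_le ht1.le (hp1' x (hballΩ hx))
      rwa [setIntegral_const, smul_eq_mul] at this
    have hI0 : 0 ≤ I := le_trans (by positivity) hIt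
    have hcI : c * I ≤ ∫ x in ball x₀ (R * ε), t ^ p x := by
      refine le_trans ?_ (mul_setIntegral_rpow_le_setIntegral_ball_mul_radius volume hlip ht1.le
        hR0 hR1)
      have hexp : t ^ (-(K * ((1 - R) * ε))) = Real.exp (-(K * ε)) := by
        rw [Real.rpow_def_of_pos ht0, hR]
        congr 1
        field_simp
        ring
      rw [hexp, finrank_euclideanSpace_fin, hc, mul_assoc]
      gcongr
    have hFI : L * m * (∫ x in ball x₀ (R * ε), t ^ p x) - B * b ≤
        ∫ x in ball x₀ ε, F x (t * H x) := by
      have h1 : L * m * (∫ x in ball x₀ (R * ε), t ^ p x) - B * b =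
          ∫ x in ball x₀ ε, ((ball x₀ (R * ε)).indicator (fun x => L * m * t ^ p x) x - B) := by
        rw [integral_sub ((hpint.const_mul _).indicator measurableSet_ball) hconst,
          setIntegral_indicator measurableSet_ball, inter_eq_right.2 (ball_subset_ball hRε),
          integral_const_mul, setIntegral_const, smul_eq_mul, mul_comm B]
      rw [h1]
      refine setIntegral_mono_on
        (((hpint.const_mul _).indicator measurableSet_ball).sub hconst) (hint t)
        measurableSet_ball fun x hx => ?_
      by_cases hxR : x ∈ ball x₀ (R * ε)
      · rw [indicator_of_mem hxR]
        have hh : ε / Real.log t ≤ H x := by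
          refine le_trans ?_ (le_max_left _ _)
          rw [mem_ball, dist_eq_norm, hR] at hxR
          rw [div_eq_mul_one_div]
          linarith
        have := mul_rpow_le_of_superlog hL (hp1' x (hballΩ hx))
          (hP x (ball_subset_closedBall hx)) hε ht1 hMt hlt hh (hM x (hballΩ hx))
        linarith
      · rw [indicator_of_notMem hxR]
        linarith [hB x (hballΩ hx) (t * H x)]
    have h2 : L * m * (c * I) = 2 * I := by
      rw [hLdef]; field_simp
    have h3 := mul_le_mul_of_nonneg_left hcI (by positivity : 0 ≤ L * m)
    linarith
  refine tendsto_atBot_mono' _ key ?_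
  exact tendsto_atBot_add_const_left _ (B * b)
    (tendsto_neg_atTop_atBot.comp (tendsto_id.const_mul_atTop hb0))
end

section
/- Let Ω ⊂ ℝ^N be an open set, p : Ω → ℝ continuous with p(x) > 0 for all x, x₀ ∈ Ω and δ > 0 with closedBall(x₀, 3δ) ⊂ Ω, and suppose min{p(x) : |x − x₀| ≤ δ} > max{p(x) : 2δ ≤ |x − x₀| ≤ 3δ}. Then for any constants C₁ > 0 and C₂ ∈ ℝ, the quantity ∫_{{2δ ≤ |x − x₀| ≤ 3δ}} (1/p(x)) · t^{p(x)} dx − C₁ · ∫_{{|x − x₀| ≤ δ}} (δt)^{p(x)} dx + C₂ tends to −∞ as t → +∞. -/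
open Set Metric Filter MeasureTheory

/-- A real power with the larger exponent and a negative coefficient wins at infinity. -/
theorem tendsto_const_mul_rpow_sub_const_mul_rpow_atBot {a b : ℝ} (hb : 0 < b) (hab : b < a)
    (K C : ℝ) {c : ℝ} (hc : 0 < c) :
    Tendsto (fun t : ℝ => K * t ^ b - c * t ^ a + C) atTop atBot := by
  have hbt : Tendsto (fun t : ℝ => t ^ b) atTop atTop := tendsto_rpow_atTop hb
  have habt : Tendsto (fun t : ℝ => t ^ (a - b)) atTop atTop :=
    tendsto_rpow_atTop (sub_pos.2 hab)
  have hsub : Tendsto (fun t : ℝ => K - c * t ^ (a - b)) atTop atBot := by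
    simpa only [sub_eq_add_neg, Function.comp_def] using
      tendsto_atBot_add_const_left _ K (tendsto_neg_atTop_atBot.comp (habt.const_mul_atTop hc))
  refine tendsto_atBot_add_const_right _ C ((hbt.atTop_mul_atBot₀ hsub).congr' ?_)
  filter_upwards [eventually_gt_atTop 0] with t ht
  have h : t ^ a = t ^ b * t ^ (a - b) := by
    rw [← Real.rpow_add ht]; congr 1; ring
  rw [h]; ring

/-- A continuous positive function on a compact set that lies below a positive number is
bounded above by a smaller positive number. -/
theorem IsCompact.exists_pos_lt_forall_le {X : Type*} [TopologicalSpace X] {s : Set X}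
    (hs : IsCompact s) {f : X → ℝ} (hf : ContinuousOn f s) (hpos : ∀ x ∈ s, 0 < f x) {a : ℝ}
    (ha : 0 < a) (hlt : ∀ x ∈ s, f x < a) : ∃ b, 0 < b ∧ b < a ∧ ∀ x ∈ s, f x ≤ b := by
  rcases s.eq_empty_or_nonempty with rfl | hne
  · exact ⟨a / 2, half_pos ha, half_lt_self ha, by simp⟩
  · obtain ⟨y, hy, hmax⟩ := hs.exists_isMaxOn hne hf
    exact ⟨f y, hpos y hy, hlt y hy, fun x hx => hmax hx⟩

/-- Upper bound for the integral of a variable power of a base at least one. -/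
theorem setIntegral_mul_rpow_le {X : Type*} [MeasurableSpace X] {μ : Measure X} {s : Set X}
    (hs : μ s < ⊤) {w p : X → ℝ} {M b t : ℝ} (hw : ∀ x ∈ s, ‖w x‖ ≤ M)
    (hp : ∀ x ∈ s, p x ≤ b) (ht : 1 ≤ t) :
    ∫ x in s, w x * t ^ p x ∂μ ≤ M * μ.real s * t ^ b := by
  have h : ‖∫ x in s, w x * t ^ p x ∂μ‖ ≤ M * t ^ b * μ.real s := by
    refine norm_setIntegral_le_of_norm_le_const hs fun x hx => ?_
    have htp : 0 ≤ t ^ p x := Real.rpow_nonneg (zero_le_one.trans ht) _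
    rw [norm_mul, Real.norm_of_nonneg htp]
    exact mul_le_mul (hw x hx) (Real.rpow_le_rpow_of_exponent_le ht (hp x hx)) htp
      ((norm_nonneg _).trans (hw x hx))
  calc _ ≤ _ := (Real.le_norm_self _).trans h
    _ = _ := by ring

/-- Lower bound for the integral of a variable power of a base at least one. -/
theorem IsCompact.measureReal_mul_rpow_le_setIntegral {X : Type*} [TopologicalSpace X] [T2Space X]
    [MeasurableSpace X] [OpensMeasurableSpace X] {μ : Measure X} [IsFiniteMeasureOnCompacts μ]
    {s : Set X} (hs : IsCompact s) {p : X → ℝ} (hp : ContinuousOn p s) {a t : ℝ}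
    (ha : ∀ x ∈ s, a ≤ p x) (ht : 1 ≤ t) :
    μ.real s * t ^ a ≤ ∫ x in s, t ^ p x ∂μ := by
  have hint : IntegrableOn (fun x => t ^ p x) s μ :=
    (continuousOn_const.rpow hp fun _ _ => Or.inl (by positivity)).integrableOn_compact hs
  calc μ.real s * t ^ a = ∫ _ in s, t ^ a ∂μ := by rw [setIntegral_const, smul_eq_mul]
    _ ≤ _ := setIntegral_mono_on (integrableOn_const hs.measure_ne_top) hint hs.measurableSet
      fun x hx => Real.rpow_le_rpow_of_exponent_le ht (ha x hx)

theorem mountain_pass_geometry_local_max {N : ℕ}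
    (Ω : Set (EuclideanSpace ℝ (Fin N))) (hΩ : IsOpen Ω)
    (p : EuclideanSpace ℝ (Fin N) → ℝ) (hp : ContinuousOn p Ω)
    (hppos : ∀ x ∈ Ω, 0 < p x)
    (x₀ : EuclideanSpace ℝ (Fin N)) (δ : ℝ) (hδ : 0 < δ)
    (hball : closedBall x₀ (3 * δ) ⊆ Ω)
    (hlocmax : ∀ x y : EuclideanSpace ℝ (Fin N),
      ‖x - x₀‖ ≤ δ → 2 * δ ≤ ‖y - x₀‖ → ‖y - x₀‖ ≤ 3 * δ → p y < p x)
    (C₁ C₂ : ℝ) (hC₁ : 0 < C₁) :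
    Filter.Tendsto (fun t : ℝ =>
      (∫ x in {x : EuclideanSpace ℝ (Fin N) | 2 * δ ≤ ‖x - x₀‖ ∧ ‖x - x₀‖ ≤ 3 * δ},
        (1 / p x) * t ^ p x) -
      C₁ * (∫ x in closedBall x₀ δ, (δ * t) ^ p x) + C₂)
      Filter.atTop Filter.atBot := by
  set A : Set (EuclideanSpace ℝ (Fin N)) :=
    {x | 2 * δ ≤ ‖x - x₀‖ ∧ ‖x - x₀‖ ≤ 3 * δ}
  have hAsub : A ⊆ closedBall x₀ (3 * δ) := fun x hx => mem_closedBall_iff_norm.2 hx.2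
  have hAclosed : IsClosed A :=
    isClosed_Icc.preimage (f := fun x : EuclideanSpace ℝ (Fin N) => ‖x - x₀‖) (by fun_prop)
  have hAc : IsCompact A := (isCompact_closedBall x₀ (3 * δ)).of_isClosed_subset hAclosed hAsub
  have hAΩ : A ⊆ Ω := hAsub.trans hball
  have hBΩ : closedBall x₀ δ ⊆ Ω := (closedBall_subset_closedBall (by linarith)).trans hball
  have hBc : IsCompact (closedBall x₀ δ) := isCompact_closedBall x₀ δ
  obtain ⟨z, hz, hmin⟩ :=
    hBc.exists_isMinOn ⟨x₀, mem_closedBall_self hδ.le⟩ (hp.mono hBΩ)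
  obtain ⟨b, hb, hba, hpb⟩ := hAc.exists_pos_lt_forall_le (hp.mono hAΩ)
    (fun x hx => hppos x (hAΩ hx)) (hppos z (hBΩ hz))
    (fun x hx => hlocmax z x (mem_closedBall_iff_norm.1 hz) hx.1 hx.2)
  obtain ⟨M, hM⟩ := hAc.exists_bound_of_continuousOn (f := fun x => 1 / p x)
    (continuousOn_const.div (hp.mono hAΩ) fun x hx => (hppos x (hAΩ hx)).ne')
  have hV : 0 < volume.real (closedBall x₀ δ) :=
    ENNReal.toReal_pos (measure_closedBall_pos volume x₀ hδ).ne' hBc.measure_ne_top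
  have hc : 0 < C₁ * (volume.real (closedBall x₀ δ) * δ ^ p z) := by positivity
  refine tendsto_atBot_mono' _ ?_ (tendsto_const_mul_rpow_sub_const_mul_rpow_atBot hb hba
    (M * volume.real A) C₂ hc)
  filter_upwards [eventually_ge_atTop 1, eventually_ge_atTop (1 / δ)] with t ht htδ
  have hδt : 1 ≤ δ * t := by rwa [div_le_iff₀' hδ] at htδ
  have hupper := setIntegral_mul_rpow_le (μ := volume) hAc.measure_lt_top hM hpb ht
  have hlower := mul_le_mul_of_nonneg_left
    (hBc.measureReal_mul_rpow_le_setIntegral (μ := volume) (hp.mono hBΩ)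
      (fun x hx => hmin hx) hδt) hC₁.le
  rw [Real.mul_rpow hδ.le (zero_le_one.trans ht)] at hlower
  linarith
end
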